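/- Let G be a finite simple graph on n vertices with vertex set {1,…,n}, let r ∈ ℕ, and let A ∈ ℂ^{nr×nr} be a matrix that r-fits G. Then there exists a unitary matrix U ∈ ℂ^{nr×nr} such that U*AU r-fits G and, for every edge ij of G, every entry of the block (U*AU)_{ij} is nonzero. -/

import Mathlib

open Matrix

/-- A symmetric matrix `A ∈ ℂ^{nr × nr}`, viewed as an `n × n` block matrix with `r × r`
blocks `A (i, ·) (j, ·)`, `r`-fits a graph `G` on vertex set `Fin n` if every diagonal block
is the identity and, for `i ≠ j`, the block `A (i, ·) (j, ·)` is zero iff `ij` is not an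
edge of `G`. -/
def RFits {n r : ℕ} (G : SimpleGraph (Fin n))
    (A : Matrix (Fin n × Fin r) (Fin n × Fin r) ℂ) : Prop :=
  A.IsSymm ∧
    (∀ i : Fin n, ∀ k l : Fin r, A (i, k) (i, l) = if k = l then 1 else 0) ∧
    (∀ i j : Fin n, i ≠ j → ((∀ k l : Fin r, A (i, k) (j, l) = 0) ↔ ¬ G.Adj i j))

/-- The reflection in the hyperplane orthogonal to `v`, scaled by `v ⬝ᵥ v` so that its entries
are polynomials in the coordinates of `v`. -/
def scaledReflection {m R : Type*} [Fintype m] [DecidableEq m] [CommRing R] (v : m → R) :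
    Matrix m m R :=
  (v ⬝ᵥ v) • (1 : Matrix m m R) - (2 : R) • vecMulVec v v

section scaledReflection

variable {m R S : Type*} [Fintype m] [DecidableEq m] [CommRing R] [CommRing S]

lemma scaledReflection_transpose (v : m → R) :
    (scaledReflection v)ᵀ = scaledReflection v := by
  simp [scaledReflection]

lemma scaledReflection_mul_self (v : m → R) :
    scaledReflection v * scaledReflection v = (v ⬝ᵥ v) ^ 2 • (1 : Matrix m m R) := by
  simp only [scaledReflection, sub_mul, mul_sub, smul_mul_assoc, mul_smul_comm, one_mul, mul_one,
    vecMulVec_mul_vecMulVec, vecMulVec_smul]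
  module

lemma scaledReflection_map (f : R →+* S) (v : m → R) :
    (scaledReflection v).map f = scaledReflection (f ∘ v) := by
  ext a b
  simp [scaledReflection, vecMulVec_apply, Matrix.one_apply, dotProduct, apply_ite f, map_ofNat]

lemma exists_scaledReflection_row (k a : m) :
    ∃ (v : m → ℂ) (c : ℂ), c ≠ 0 ∧ (scaledReflection v) k = c • Pi.single a 1 := by
  by_cases h : k = a
  · subst h
    refine ⟨Pi.single k 1, -1, by norm_num, ?_⟩
    ext b
    by_cases hb : k = b
    · subst hb
      simp [scaledReflection, vecMulVec_apply]
      norm_num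
    · simp [scaledReflection, vecMulVec_apply, hb, Ne.symm hb]
  · refine ⟨Pi.single k 1 - Pi.single a 1, 2, by norm_num, ?_⟩
    ext b
    by_cases hb : k = b
    · subst hb
      simp [scaledReflection, vecMulVec_apply, h, Ne.symm h]
      norm_num
    · by_cases hab : a = b
      · subst hab
        simp [scaledReflection, vecMulVec_apply, h, Ne.symm h]
      · simp [scaledReflection, vecMulVec_apply, h, hb, Ne.symm h, Ne.symm hb, Ne.symm hab]

lemma exists_scaledReflection_mul_mul_ne_zero {B : Matrix m m ℂ} (hB : B ≠ 0) (k l : m) :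
    ∃ v w : m → ℂ, (scaledReflection v * B * scaledReflection w) k l ≠ 0 := by
  obtain ⟨a, b, hab⟩ : ∃ a b, B a b ≠ 0 := by
    by_contra! h
    exact hB (Matrix.ext h)
  obtain ⟨v, c, hc, hv⟩ := exists_scaledReflection_row k a
  obtain ⟨w, d, hd, hw⟩ := exists_scaledReflection_row l b
  refine ⟨v, w, ?_⟩
  have hw' (x : m) : scaledReflection w x l = (d • Pi.single b 1 : m → ℂ) x := by
    rw [← hw, ← scaledReflection_transpose w, transpose_apply, scaledReflection_transpose]
  simp [mul_apply, hv, hw', Pi.single_apply, hc, hd, hab]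

end scaledReflection

lemma MvPolynomial.exists_ofReal_eval_ne_zero {σ : Type*} {p : MvPolynomial σ ℂ} (hp : p ≠ 0) :
    ∃ x : σ → ℝ, MvPolynomial.eval (fun s => (x s : ℂ)) p ≠ 0 := by
  by_contra! h
  refine hp (MvPolynomial.funext_set (fun _ => Set.range ((↑) : ℝ → ℂ))
    (fun _ => Set.infinite_range_of_injective Complex.ofReal_injective) fun x hx => ?_)
  choose y hy using fun s => hx s (Set.mem_univ s)
  obtain rfl : (fun s => (y s : ℂ)) = x := _root_.funext hy
  simpa using h y

/-- Finitely many nonzero off-diagonal blocks become entrywise nonzero under a common real choice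
of one scaled reflection per block index. -/
lemma exists_real_scaledReflection_ne_zero {ι m : Type*} [Fintype ι] [Fintype m] [DecidableEq m]
    (A : Matrix (ι × m) (ι × m) ℂ) :
    ∃ x : ι → m → ℝ, (∀ i k, x i k ≠ 0) ∧
      ∀ i j, i ≠ j → A.submatrix (Prod.mk i) (Prod.mk j) ≠ 0 → ∀ k l,
        (scaledReflection (fun a => (x i a : ℂ)) * A.submatrix (Prod.mk i) (Prod.mk j) *
          scaledReflection (fun a => (x j a : ℂ))) k l ≠ 0 := by
  classical
  let M (i j : ι) : Matrix m m (MvPolynomial (ι × m) ℂ) :=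
    scaledReflection (fun a => MvPolynomial.X (i, a)) *
      (A.submatrix (Prod.mk i) (Prod.mk j)).map MvPolynomial.C *
        scaledReflection (fun a => MvPolynomial.X (j, a))
  let P (q : (ι × ι) × m × m) : MvPolynomial (ι × m) ℂ := M q.1.1 q.1.2 q.2.1 q.2.2
  have hM (x : ι × m → ℂ) (i j : ι) : (M i j).map (MvPolynomial.eval x) =
      scaledReflection (fun a => x (i, a)) * A.submatrix (Prod.mk i) (Prod.mk j) *
        scaledReflection (fun a => x (j, a)) := by
    have hX (i : ι) : (scaledReflection fun a : m =>
        (MvPolynomial.X (i, a) : MvPolynomial (ι × m) ℂ)).map (MvPolynomial.eval x) =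
          scaledReflection fun a => x (i, a) := by
      rw [scaledReflection_map]
      congr 1
      ext a
      simp
    have hC : ((A.submatrix (Prod.mk i) (Prod.mk j)).map MvPolynomial.C).map
        (MvPolynomial.eval x) = A.submatrix (Prod.mk i) (Prod.mk j) := by
      ext a b
      simp
    rw [Matrix.map_mul, Matrix.map_mul, hX, hX, hC]
  have hP (x : ι × m → ℂ) (i j k l) : MvPolynomial.eval x (P ((i, j), k, l)) =
      (scaledReflection (fun a => x (i, a)) * A.submatrix (Prod.mk i) (Prod.mk j) *
        scaledReflection (fun a => x (j, a))) k l := congrFun₂ (hM x i j) k l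
  have hne : (∏ p : ι × m, MvPolynomial.X p) *
      ∏ q with q.1.1 ≠ q.1.2 ∧ A.submatrix (Prod.mk q.1.1) (Prod.mk q.1.2) ≠ 0, P q ≠ 0 := by
    refine mul_ne_zero (Finset.prod_ne_zero_iff.2 fun _ _ => MvPolynomial.X_ne_zero _)
      (Finset.prod_ne_zero_iff.2 ?_)
    rintro ⟨⟨i, j⟩, k, l⟩ hq h0
    obtain ⟨hij, hB⟩ := (Finset.mem_filter.1 hq).2
    obtain ⟨v, w, hvw⟩ := exists_scaledReflection_mul_mul_ne_zero hB k l
    apply hvw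
    simpa [h0, Ne.symm hij] using (hP (fun p => if p.1 = i then v p.2 else w p.2) i j k l).symm
  obtain ⟨x, hx⟩ := MvPolynomial.exists_ofReal_eval_ne_zero hne
  rw [map_mul, map_prod, map_prod] at hx
  have hx₁ := Finset.prod_ne_zero_iff.1 (left_ne_zero_of_mul hx)
  have hx₂ := Finset.prod_ne_zero_iff.1 (right_ne_zero_of_mul hx)
  refine ⟨fun i k => x (i, k), fun i k => by simpa using hx₁ (i, k) (Finset.mem_univ _),
    fun i j hij hB k l => ?_⟩
  rw [← hP (fun p => (x p : ℂ))]
  exact hx₂ ((i, j), k, l) (Finset.mem_filter.2 ⟨Finset.mem_univ _, hij, hB⟩)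

/-- A nonzero scalar multiple of `scaledReflection` of a nonvanishing real vector is real symmetric
and involutive. -/
lemma normalized_scaledReflection {m : Type*} [Fintype m] [DecidableEq m] (x : m → ℝ)
    (hx : ∀ k, x k ≠ 0) :
    ∃ c : ℂ, c ≠ 0 ∧ ∃ O : Matrix m m ℂ, O = c • scaledReflection (fun a => (x a : ℂ)) ∧
      Oᵀ = O ∧ Oᴴ = O ∧ O * O = 1 := by
  rcases isEmpty_or_nonempty m with h | ⟨⟨k⟩⟩
  · exact ⟨1, one_ne_zero, _, rfl, Subsingleton.elim _ _, Subsingleton.elim _ _,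
      Subsingleton.elim _ _⟩
  have hpos : 0 < x ⬝ᵥ x := Finset.sum_pos' (fun a _ => mul_self_nonneg _)
    ⟨k, Finset.mem_univ k, mul_self_pos.2 (hx k)⟩
  have hcast : (fun a => (x a : ℂ)) ⬝ᵥ (fun a => (x a : ℂ)) = ((x ⬝ᵥ x : ℝ) : ℂ) := by
    simp [dotProduct]
  have hs : ((x ⬝ᵥ x : ℝ) : ℂ) ≠ 0 := Complex.ofReal_ne_zero.2 hpos.ne'
  refine ⟨((x ⬝ᵥ x : ℝ) : ℂ)⁻¹, inv_ne_zero hs, _, rfl, ?_, ?_, ?_⟩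
  · rw [transpose_smul, scaledReflection_transpose]
  · have h : (scaledReflection fun a => (x a : ℂ))ᴴ = scaledReflection fun a => (x a : ℂ) := by
      rw [conjTranspose, scaledReflection_transpose]
      refine (scaledReflection_map (starRingEnd ℂ) _).trans ?_
      congr 1
      ext
      simp
    rw [conjTranspose_smul, h]
    simp
  · rw [smul_mul_smul_comm, scaledReflection_mul_self, hcast, smul_smul]
    have : ((x ⬝ᵥ x : ℝ) : ℂ)⁻¹ * ((x ⬝ᵥ x : ℝ) : ℂ)⁻¹ * ((x ⬝ᵥ x : ℝ) : ℂ) ^ 2 = 1 := by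
      field_simp
    rw [this, one_smul]

/-- The block diagonal matrix with diagonal blocks `O i`, with the block index first. -/
def blockDiagonalProd {ι m : Type*} [DecidableEq ι] (O : ι → Matrix m m ℂ) :
    Matrix (ι × m) (ι × m) ℂ :=
  Matrix.of fun p q => if p.1 = q.1 then O p.1 p.2 q.2 else 0

lemma blockDiagonalProd_mul_mul {ι m : Type*} [Fintype ι] [DecidableEq ι] [Fintype m]
    (O : ι → Matrix m m ℂ) (A : Matrix (ι × m) (ι × m) ℂ) (i j : ι) (k l : m) :
    (blockDiagonalProd O * A * blockDiagonalProd O) (i, k) (j, l) =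
      (O i * A.submatrix (Prod.mk i) (Prod.mk j) * O j) k l := by
  simp [blockDiagonalProd, mul_apply, Fintype.sum_prod_type]

theorem stmt0 {n r : ℕ} (G : SimpleGraph (Fin n))
    (A : Matrix (Fin n × Fin r) (Fin n × Fin r) ℂ) (hA : RFits G A) :
    ∃ U : Matrix (Fin n × Fin r) (Fin n × Fin r) ℂ,
      U ∈ Matrix.unitaryGroup (Fin n × Fin r) ℂ ∧
        RFits G (Uᴴ * A * U) ∧
        ∀ i j : Fin n, G.Adj i j → ∀ k l : Fin r, (Uᴴ * A * U) (i, k) (j, l) ≠ 0 := by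
  obtain ⟨hsymm, hdiag, hoff⟩ := hA
  obtain ⟨x, hx, hne⟩ := exists_real_scaledReflection_ne_zero A
  choose c hc O hO hOt hOh hOO using fun i => normalized_scaledReflection (x i) (hx i)
  have hUt : (blockDiagonalProd O)ᵀ = blockDiagonalProd O := by
    ext ⟨i, k⟩ ⟨j, l⟩
    by_cases h : i = j
    · subst h
      simpa [blockDiagonalProd] using congrFun₂ (hOt i) k l
    · simp [blockDiagonalProd, h, Ne.symm h]
  have hUh : (blockDiagonalProd O)ᴴ = blockDiagonalProd O := by
    ext ⟨i, k⟩ ⟨j, l⟩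
    by_cases h : i = j
    · subst h
      simpa [blockDiagonalProd] using congrFun₂ (hOh i) k l
    · simp [blockDiagonalProd, h, Ne.symm h]
  have hzero {i j : Fin n} (h : ¬ G.Adj i j) (hij : i ≠ j) :
      A.submatrix (Prod.mk i) (Prod.mk j) = 0 := Matrix.ext ((hoff i j hij).2 h)
  have hnz {i j : Fin n} (h : G.Adj i j) : A.submatrix (Prod.mk i) (Prod.mk j) ≠ 0 := fun h0 =>
    (hoff i j h.ne).1 (fun k l => congrFun₂ h0 k l) h
  have hadj (i j : Fin n) (h : G.Adj i j) (k l : Fin r) :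
      (blockDiagonalProd O * A * blockDiagonalProd O) (i, k) (j, l) ≠ 0 := by
    rw [blockDiagonalProd_mul_mul, hO, hO]
    simpa [hc] using hne i j h.ne (hnz h) k l
  have hone (i : Fin n) : A.submatrix (Prod.mk i) (Prod.mk i) = 1 := by
    ext k l
    simp [hdiag, one_apply]
  refine ⟨blockDiagonalProd O, ?_, ?_, ?_⟩
  · rw [mem_unitaryGroup_iff', star_eq_conjTranspose, hUh]
    ext ⟨i, k⟩ ⟨j, l⟩
    have h := blockDiagonalProd_mul_mul O 1 i j k l
    rw [mul_one] at h
    rw [h]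
    by_cases hij : i = j
    · subst hij
      have h1 : (1 : Matrix (Fin n × Fin r) (Fin n × Fin r) ℂ).submatrix (Prod.mk i) (Prod.mk i) =
          1 := submatrix_one _ (Prod.mk_right_injective i)
      rw [h1, mul_one, hOO]
      simp [one_apply]
    · have h0 : (1 : Matrix (Fin n × Fin r) (Fin n × Fin r) ℂ).submatrix (Prod.mk i) (Prod.mk j) =
          0 := by
        ext
        simp [one_apply, hij]
      rw [h0]
      simp [one_apply, hij]
  · rw [hUh]
    refine ⟨?_, fun i k l => ?_, fun i j hij => ⟨fun h hG => ?_, fun h k l => ?_⟩⟩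
    · rw [IsSymm, transpose_mul, transpose_mul, hUt, hsymm, Matrix.mul_assoc]
    · rw [blockDiagonalProd_mul_mul, hone, mul_one, hOO, one_apply]
    · obtain ⟨k, l, -⟩ : ∃ k l : Fin r, A (i, k) (j, l) ≠ 0 := by
        by_contra! h0
        exact hnz hG (Matrix.ext h0)
      exact hadj i j hG k l (h k l)
    · rw [blockDiagonalProd_mul_mul, hzero h hij]
      simp
  · rwa [hUh]
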